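/- Let Ω ⊂ ℂ be a bounded simply connected domain with diam(Ω) ≤ 1 and let α ∈ (0, 2]. Let h ∈ C²(Ω) ∩ C(closure Ω) satisfy h = 0 on ∂Ω and |Δh(u)| ≤ dist(u, ∂Ω)^{−2+α} for all u ∈ Ω. Then there exist constants C(α) > 0 and β(α) > 0 (one may take β(α) = α/5) depending only on α such that |h(w)| ≤ C(α)·dist(w, ∂Ω)^{β(α)} for all w ∈ Ω. -/

import Mathlib

open Set Filter Topology MeasureTheory

open scoped Laplacian

/-- Differentiation under the integral sign for a jointly continuous derivative. -/
lemma hasDerivAt_intervalIntegral_of_continuous {F F' : ℝ → ℝ → ℝ} {a b : ℝ}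
    (hF : ∀ t, Continuous (F t)) (hF' : Continuous (Function.uncurry F'))
    (h : ∀ t θ, HasDerivAt (fun s ↦ F s θ) (F' t θ) t) (t : ℝ) :
    HasDerivAt (fun s ↦ ∫ θ in a..b, F s θ) (∫ θ in a..b, F' t θ) t := by
  obtain ⟨M, hM⟩ := ((isCompact_Icc (a := t - 1) (b := t + 1)).prod
    (isCompact_uIcc (a := a) (b := b))).exists_bound_of_continuousOn hF'.continuousOn
  refine (intervalIntegral.hasDerivAt_integral_of_dominated_loc_of_deriv_le
    (s := Icc (t - 1) (t + 1)) (bound := fun _ ↦ M)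
    (Icc_mem_nhds (by linarith) (by linarith)) ?_ ?_ ?_ ?_ ?_ ?_).2
  · exact .of_forall fun s ↦ (hF s).aestronglyMeasurable
  · exact (hF t).intervalIntegrable _ _
  · exact (hF'.comp (Continuous.prodMk_right t)).aestronglyMeasurable
  · exact .of_forall fun θ hθ s hs ↦ hM (s, θ) ⟨hs, uIoc_subset_uIcc hθ⟩
  · exact intervalIntegrable_const
  · exact .of_forall fun θ _ s _ ↦ h s θ

/-- A point of the circle with centre `c` and radius `exp t`. -/
noncomputable def logPolar (c : ℂ) (t θ : ℝ) : ℂ := c + Complex.exp (t + θ * Complex.I)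

section logPolar

variable (c : ℂ) (t θ : ℝ)

lemma continuous_logPolar : Continuous fun x : ℝ × ℝ ↦ logPolar c x.1 x.2 := by
  unfold logPolar; fun_prop

lemma dist_logPolar : dist (logPolar c t θ) c = Real.exp t := by
  simp [logPolar, dist_eq_norm, Complex.norm_exp]

lemma logPolar_periodic : logPolar c t (θ + 2 * Real.pi) = logPolar c t θ := by
  simp only [logPolar, Complex.ofReal_add, Complex.ofReal_mul, Complex.ofReal_ofNat, add_mul,
    ← add_assoc, Complex.exp_add, Complex.exp_two_pi_mul_I, mul_one]

lemma hasDerivAt_logPolar_fst :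
    HasDerivAt (fun s ↦ logPolar c s θ) (logPolar 0 t θ) t := by
  have h : HasDerivAt (fun s : ℝ ↦ (s : ℂ) + θ * Complex.I) 1 t :=
    Complex.ofRealCLM.hasDerivAt.add_const _
  simpa [logPolar] using h.cexp.const_add c

lemma hasDerivAt_logPolar_snd :
    HasDerivAt (fun s ↦ logPolar c t s) (Complex.I * logPolar 0 t θ) θ := by
  have h : HasDerivAt (fun s : ℝ ↦ (t : ℂ) + s * Complex.I) (1 * Complex.I) θ :=
    (Complex.ofRealCLM.hasDerivAt.mul_const _).const_add _
  simpa [logPolar, mul_comm] using h.cexp.const_add c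

end logPolar

section circleIntegral

variable {p : ℂ → ℝ} (hp : ContDiff ℝ 2 p) (c : ℂ)

lemma laplacian_eq_fderiv (p : ℂ → ℝ) (z : ℂ) :
    Δ p z = fderiv ℝ (fderiv ℝ p) z 1 1 + fderiv ℝ (fderiv ℝ p) z Complex.I Complex.I := by
  simp [InnerProductSpace.laplacian_eq_iteratedFDeriv_complexPlane, iteratedFDeriv_two_apply]

include hp

lemma hasDerivAt_comp_logPolar_fst (t θ : ℝ) :
    HasDerivAt (fun s ↦ p (logPolar c s θ)) (fderiv ℝ p (logPolar c t θ) (logPolar 0 t θ)) t :=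
  ((hp.differentiable (by norm_num)) _).hasFDerivAt.comp_hasDerivAt t
    (hasDerivAt_logPolar_fst c t θ)

lemma hasDerivAt_comp_logPolar_snd (t θ : ℝ) :
    HasDerivAt (fun s ↦ p (logPolar c t s))
      (fderiv ℝ p (logPolar c t θ) (Complex.I * logPolar 0 t θ)) θ :=
  ((hp.differentiable (by norm_num)) _).hasFDerivAt.comp_hasDerivAt θ
    (hasDerivAt_logPolar_snd c t θ)

lemma hasDerivAt_fderiv_logPolar_fst (t θ : ℝ) :
    HasDerivAt (fun s ↦ fderiv ℝ p (logPolar c s θ) (logPolar 0 s θ))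
      (fderiv ℝ (fderiv ℝ p) (logPolar c t θ) (logPolar 0 t θ) (logPolar 0 t θ)
        + fderiv ℝ p (logPolar c t θ) (logPolar 0 t θ)) t :=
  ((((hp.fderiv_right (m := 1) (by norm_num)).differentiable
    (by norm_num)) _).hasFDerivAt.comp_hasDerivAt t (hasDerivAt_logPolar_fst c t θ)).clm_apply
    (hasDerivAt_logPolar_fst 0 t θ)

lemma hasDerivAt_fderiv_logPolar_snd (t θ : ℝ) :
    HasDerivAt (fun s ↦ fderiv ℝ p (logPolar c t s) (Complex.I * logPolar 0 t s))
      (fderiv ℝ (fderiv ℝ p) (logPolar c t θ) (Complex.I * logPolar 0 t θ)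
          (Complex.I * logPolar 0 t θ)
        - fderiv ℝ p (logPolar c t θ) (logPolar 0 t θ)) θ := by
  have := ((((hp.fderiv_right (m := 1) (by norm_num)).differentiable
    (by norm_num)) _).hasFDerivAt.comp_hasDerivAt θ (hasDerivAt_logPolar_snd c t θ)).clm_apply
    ((hasDerivAt_logPolar_snd 0 t θ).const_mul Complex.I)
  simpa [← mul_assoc, ← sub_eq_add_neg] using this

lemma continuous_fderiv_logPolar :
    Continuous (Function.uncurry fun t θ ↦ fderiv ℝ p (logPolar c t θ) (logPolar 0 t θ)) :=
  ((hp.continuous_fderiv (by norm_num)).comp (continuous_logPolar c)).clm_apply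
    (continuous_logPolar 0)

lemma continuous_fderiv_fderiv : Continuous (fderiv ℝ (fderiv ℝ p)) :=
  (hp.fderiv_right (m := 1) (by norm_num)).continuous_fderiv (by norm_num)

lemma continuous_laplacian : Continuous (Δ p) := by
  have := continuous_fderiv_fderiv hp
  simp only [funext (laplacian_eq_fderiv p)]
  fun_prop

/-- The trace of a symmetric bilinear form over an orthogonal frame of vectors of equal length. -/
lemma fderiv_fderiv_add_eq_laplacian (z v : ℂ) :
    fderiv ℝ (fderiv ℝ p) z v v + fderiv ℝ (fderiv ℝ p) z (Complex.I * v) (Complex.I * v)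
      = ‖v‖ ^ 2 * Δ p z := by
  have hsymm : fderiv ℝ (fderiv ℝ p) z 1 Complex.I = fderiv ℝ (fderiv ℝ p) z Complex.I 1 :=
    (hp.contDiffAt.isSymmSndFDerivAt (by simp)) _ _
  have hv : v = v.re • (1 : ℂ) + v.im • Complex.I := by simp [Complex.re_add_im]
  have hv' : Complex.I * v = (-v.im) • (1 : ℂ) + v.re • Complex.I := by
    apply Complex.ext <;> simp
  rw [laplacian_eq_fderiv, hv', ← Complex.normSq_eq_norm_sq, Complex.normSq_apply]
  conv_lhs => enter [1]; rw [hv]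
  simp only [map_add, map_smul, add_apply, smul_apply,
    smul_eq_mul, hsymm]
  ring

lemma hasDerivAt_integral_logPolar (t : ℝ) :
    HasDerivAt (fun s ↦ ∫ θ in -Real.pi..Real.pi, p (logPolar c s θ))
      (∫ θ in -Real.pi..Real.pi, fderiv ℝ p (logPolar c t θ) (logPolar 0 t θ)) t :=
  hasDerivAt_intervalIntegral_of_continuous (F := fun s θ ↦ p (logPolar c s θ))
    (fun s ↦ hp.continuous.comp ((continuous_logPolar c).comp (Continuous.prodMk_right s)))
    (continuous_fderiv_logPolar hp c) (hasDerivAt_comp_logPolar_fst hp c) t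

lemma hasDerivAt_integral_fderiv_logPolar (t : ℝ) :
    HasDerivAt (fun s ↦ ∫ θ in -Real.pi..Real.pi, fderiv ℝ p (logPolar c s θ) (logPolar 0 s θ))
      (Real.exp t ^ 2 * ∫ θ in -Real.pi..Real.pi, Δ p (logPolar c t θ)) t := by
  have hD2 := continuous_fderiv_fderiv hp
  have hD1 := hp.continuous_fderiv (by norm_num)
  have hL (b : ℂ) : Continuous (logPolar b t) :=
    (continuous_logPolar b).comp (Continuous.prodMk_right t)
  have hc := continuous_logPolar c
  have h0 := continuous_logPolar 0
  have key := hasDerivAt_intervalIntegral_of_continuous (a := -Real.pi) (b := Real.pi)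
    (F := fun s θ ↦ fderiv ℝ p (logPolar c s θ) (logPolar 0 s θ))
    (fun s ↦ (continuous_fderiv_logPolar hp c).comp (Continuous.prodMk_right s))
    (by simp only [Function.uncurry_def]; fun_prop) (hasDerivAt_fderiv_logPolar_fst hp c) t
  have hper := intervalIntegral.integral_eq_sub_of_hasDerivAt (a := -Real.pi) (b := Real.pi)
    (fun θ _ ↦ hasDerivAt_fderiv_logPolar_snd hp c t θ)
    (by have := hL c; have := hL 0; apply Continuous.intervalIntegrable; fun_prop)
  have hpi (b : ℂ) : logPolar b t Real.pi = logPolar b t (-Real.pi) := by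
    rw [← logPolar_periodic b t (-Real.pi)]; congr 1; ring
  rw [hpi, hpi, sub_self] at hper
  convert key using 1
  rw [← add_zero (∫ θ in -Real.pi..Real.pi, _ + _), ← hper, ← intervalIntegral.integral_add,
    ← intervalIntegral.integral_const_mul]
  · congr 1 with θ
    have := fderiv_fderiv_add_eq_laplacian hp (logPolar c t θ) (logPolar 0 t θ)
    rw [show ‖logPolar 0 t θ‖ = Real.exp t by simpa using dist_logPolar 0 t θ] at this
    linarith
  all_goals
    have := hL c; have := hL 0
    apply Continuous.intervalIntegrable; fun_prop

end circleIntegral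

lemma logPolar_eq (c : ℂ) (t θ : ℝ) :
    logPolar c t θ = c + Real.exp t * Complex.exp (θ * Complex.I) := by
  simp [logPolar, Complex.exp_add]

/-- The mean value inequality over circles for a function whose Laplacian is bounded below. -/
lemma two_pi_mul_le_integral_logPolar {p : ℂ → ℝ} (hp : ContDiff ℝ 2 p) {S : ℝ}
    (hS : ∀ z, -S ≤ Δ p z) (c : ℂ) (t : ℝ) :
    2 * Real.pi * p c ≤
      (∫ θ in -Real.pi..Real.pi, p (logPolar c t θ)) + Real.pi / 2 * S * Real.exp t ^ 2 := by
  have hπ := Real.pi_pos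
  have hD1 := hp.continuous_fderiv (by norm_num)
  have hexp2 (s : ℝ) : HasDerivAt (fun s ↦ Real.exp s ^ 2) (2 * Real.exp s ^ 2) s := by
    refine ((Real.hasDerivAt_exp s).fun_pow 2).congr_deriv ?_
    ring
  set N := fun s ↦ ∫ θ in -Real.pi..Real.pi, p (logPolar c s θ) with hN
  set N' := fun s ↦ ∫ θ in -Real.pi..Real.pi, fderiv ℝ p (logPolar c s θ) (logPolar 0 s θ) with hN'
  have hexp0 : Tendsto (fun s ↦ Real.exp s ^ 2) atBot (𝓝 0) := by
    simpa using Real.tendsto_exp_atBot.pow 2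
  have hmono' : Monotone fun s ↦ N' s + Real.pi * S * Real.exp s ^ 2 := by
    have hd (s : ℝ) := (hasDerivAt_integral_fderiv_logPolar hp c s).add
      ((hexp2 s).const_mul (Real.pi * S))
    refine monotone_of_hasDerivAt_nonneg hd fun s ↦ ?_
    have : ∫ θ in -Real.pi..Real.pi, -S ≤ ∫ θ in -Real.pi..Real.pi, Δ p (logPolar c s θ) := by
      refine intervalIntegral.integral_mono (by linarith) intervalIntegrable_const ?_
        fun θ ↦ hS _
      exact ((continuous_laplacian hp).comp
        ((continuous_logPolar c).comp (Continuous.prodMk_right s))).intervalIntegrable _ _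
    rw [intervalIntegral.integral_const, smul_eq_mul] at this
    have := mul_le_mul_of_nonneg_left this (sq_nonneg (Real.exp s))
    simp only [Pi.zero_apply]
    linarith
  have hlim' : Tendsto (fun s ↦ N' s + Real.pi * S * Real.exp s ^ 2) atBot (𝓝 0) := by
    have hcont : Continuous fun r : ℝ ↦ ∫ θ in -Real.pi..Real.pi,
        fderiv ℝ p (c + r * Complex.exp (θ * Complex.I)) (Complex.exp (θ * Complex.I)) := by
      apply intervalIntegral.continuous_parametric_intervalIntegral_of_continuous'
      fun_prop
    have hN'_eq (s : ℝ) : N' s = Real.exp s * ∫ θ in -Real.pi..Real.pi,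
        fderiv ℝ p (c + Real.exp s * Complex.exp (θ * Complex.I)) (Complex.exp (θ * Complex.I)) := by
      rw [← intervalIntegral.integral_const_mul]
      simp only [hN', logPolar_eq, zero_add, ← Complex.real_smul, map_smul, smul_eq_mul]
    have := (Real.tendsto_exp_atBot.mul ((hcont.tendsto 0).comp Real.tendsto_exp_atBot)).add
      (hexp0.const_mul (Real.pi * S))
    simpa [hN'_eq] using this
  have hmono : Monotone fun s ↦ N s + Real.pi / 2 * S * Real.exp s ^ 2 := by
    have hd (s : ℝ) := (hasDerivAt_integral_logPolar hp c s).add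
      ((hexp2 s).const_mul (Real.pi / 2 * S))
    refine monotone_of_hasDerivAt_nonneg hd fun s ↦ ?_
    have := hmono'.le_of_tendsto hlim' s
    simp only [hN', Pi.zero_apply] at this ⊢
    linarith
  have hlim : Tendsto (fun s ↦ N s + Real.pi / 2 * S * Real.exp s ^ 2) atBot
      (𝓝 (2 * Real.pi * p c)) := by
    have hcont : Continuous fun r : ℝ ↦ ∫ θ in -Real.pi..Real.pi,
        p (c + r * Complex.exp (θ * Complex.I)) := by
      apply intervalIntegral.continuous_parametric_intervalIntegral_of_continuous'
      have := hp.continuous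
      fun_prop
    have := ((hcont.tendsto 0).comp Real.tendsto_exp_atBot).add
      (hexp0.const_mul (Real.pi / 2 * S))
    simpa [hN, logPolar_eq, Function.comp_def, ← two_mul] using this
  exact hmono.le_of_tendsto hlim t

/-- The Cauchy–Schwarz inequality for continuous functions on an interval. -/
lemma sq_intervalIntegral_mul_le {f g : ℝ → ℝ} (hf : Continuous f) (hg : Continuous g) {a b : ℝ}
    (hab : a ≤ b) :
    (∫ x in a..b, f x * g x) ^ 2 ≤ (∫ x in a..b, f x ^ 2) * ∫ x in a..b, g x ^ 2 := by
  have h (s : ℝ) : 0 ≤ (∫ x in a..b, f x ^ 2) * (s * s) + (2 * ∫ x in a..b, f x * g x) * s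
      + ∫ x in a..b, g x ^ 2 := by
    have : 0 ≤ ∫ x in a..b, (s * f x + g x) ^ 2 :=
      intervalIntegral.integral_nonneg hab fun x _ ↦ sq_nonneg _
    have e : (fun x ↦ (s * f x + g x) ^ 2) =
        fun x ↦ s * s * f x ^ 2 + 2 * s * (f x * g x) + g x ^ 2 := by
      ext x; ring
    rw [e, intervalIntegral.integral_add, intervalIntegral.integral_add,
      intervalIntegral.integral_const_mul, intervalIntegral.integral_const_mul] at this
    · linarith
    all_goals apply Continuous.intervalIntegrable; fun_prop
  have := discrim_le_zero h
  rw [discrim] at this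
  linarith

/-- Poincaré's inequality on an interval for functions vanishing at the left endpoint. -/
lemma intervalIntegral_sq_le_of_left_eq_zero {f f' : ℝ → ℝ} (hf : ∀ x, HasDerivAt f (f' x) x)
    (hf' : Continuous f') {a b : ℝ} (hab : a ≤ b) (ha : f a = 0) :
    ∫ x in a..b, f x ^ 2 ≤ (b - a) ^ 2 / 2 * ∫ x in a..b, f' x ^ 2 := by
  have hfc : Continuous f := continuous_iff_continuousAt.2 fun x ↦ (hf x).continuousAt
  have hpt : ∀ x ∈ Icc a b, f x ^ 2 ≤ (x - a) * ∫ x in a..b, f' x ^ 2 := by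
    intro x hx
    have h1 := intervalIntegral.integral_eq_sub_of_hasDerivAt (a := a) (b := x)
      (fun y _ ↦ hf y) (hf'.intervalIntegrable _ _)
    have h2 := sq_intervalIntegral_mul_le (f := fun _ ↦ 1) continuous_const hf' hx.1
    simp only [one_mul, h1, ha, sub_zero, one_pow, intervalIntegral.integral_const, smul_eq_mul,
      mul_one] at h2
    refine h2.trans (mul_le_mul_of_nonneg_left ?_ (by linarith [hx.1]))
    exact intervalIntegral.integral_mono_interval le_rfl hx.1 hx.2
      (.of_forall fun y ↦ sq_nonneg _) ((hf'.pow 2).intervalIntegrable _ _)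
  calc ∫ x in a..b, f x ^ 2 ≤ ∫ x in a..b, (x - a) * ∫ x in a..b, f' x ^ 2 :=
        intervalIntegral.integral_mono_on hab ((hfc.pow 2).intervalIntegrable _ _)
          (by apply Continuous.intervalIntegrable; fun_prop) hpt
    _ = (b - a) ^ 2 / 2 * ∫ x in a..b, f' x ^ 2 := by
        rw [intervalIntegral.integral_mul_const,
          intervalIntegral.integral_comp_sub_right (fun x ↦ x), integral_id]
        simp

/-- Poincaré's inequality on an interval for functions vanishing at the right endpoint. -/
lemma intervalIntegral_sq_le_of_right_eq_zero {f f' : ℝ → ℝ} (hf : ∀ x, HasDerivAt f (f' x) x)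
    (hf' : Continuous f') {a b : ℝ} (hab : a ≤ b) (hb : f b = 0) :
    ∫ x in a..b, f x ^ 2 ≤ (b - a) ^ 2 / 2 * ∫ x in a..b, f' x ^ 2 := by
  have h := intervalIntegral_sq_le_of_left_eq_zero (f := fun x ↦ f (-x)) (f' := fun x ↦ -f' (-x))
    (fun x ↦ by simpa [Function.comp_def] using (hf (-x)).comp x (hasDerivAt_neg x)) (by fun_prop)
    (neg_le_neg hab) (by simpa using hb)
  simp only [neg_sq] at h
  rw [intervalIntegral.integral_comp_neg (fun x ↦ f x ^ 2),
    intervalIntegral.integral_comp_neg (fun x ↦ f' x ^ 2)] at h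
  convert h using 2 <;> ring_nf

/-- A Wirtinger inequality, with a non-optimal constant, for `2π`-periodic functions with a zero. -/
lemma integral_sq_le_of_periodic_of_eq_zero {f f' : ℝ → ℝ} (hf : ∀ x, HasDerivAt f (f' x) x)
    (hf' : Continuous f') (hper : Function.Periodic f (2 * Real.pi))
    (hper' : Function.Periodic f' (2 * Real.pi)) {x₀ : ℝ} (h0 : f x₀ = 0) :
    ∫ x in -Real.pi..Real.pi, f x ^ 2 ≤ 5 * ∫ x in -Real.pi..Real.pi, f' x ^ 2 := by
  have hfc : Continuous f := continuous_iff_continuousAt.2 fun x ↦ (hf x).continuousAt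
  have hπ := Real.pi_pos
  have shift {g : ℝ → ℝ} (hg : Continuous g) (hgper : Function.Periodic g (2 * Real.pi)) :
      ∫ x in -Real.pi..Real.pi, g x ^ 2 = (∫ x in x₀..x₀ + Real.pi, g x ^ 2)
        + ∫ x in x₀ + Real.pi..x₀ + 2 * Real.pi, g x ^ 2 := by
    have hg2 : Continuous fun x ↦ g x ^ 2 := hg.pow 2
    rw [intervalIntegral.integral_add_adjacent_intervals
      (hg2.intervalIntegrable _ _) (hg2.intervalIntegrable _ _)]
    have : Function.Periodic (fun x ↦ g x ^ 2) (2 * Real.pi) := fun x ↦ by simp only [hgper x]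
    rw [← this.intervalIntegral_add_eq (-Real.pi) x₀]
    ring_nf
  have h1 := intervalIntegral_sq_le_of_left_eq_zero hf hf' (b := x₀ + Real.pi) (by linarith) h0
  have h2 := intervalIntegral_sq_le_of_right_eq_zero hf hf' (a := x₀ + Real.pi)
    (b := x₀ + 2 * Real.pi) (by linarith) (by rw [hper, h0])
  rw [show x₀ + Real.pi - x₀ = Real.pi by ring] at h1
  rw [show x₀ + 2 * Real.pi - (x₀ + Real.pi) = Real.pi by ring] at h2
  rw [shift hfc hper, shift hf' hper']
  have n1 : 0 ≤ ∫ x in x₀..x₀ + Real.pi, f' x ^ 2 :=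
    intervalIntegral.integral_nonneg (by linarith) fun x _ ↦ sq_nonneg _
  have n2 : 0 ≤ ∫ x in x₀ + Real.pi..x₀ + 2 * Real.pi, f' x ^ 2 :=
    intervalIntegral.integral_nonneg (by linarith) fun x _ ↦ sq_nonneg _
  have hπ2 : Real.pi ^ 2 / 2 ≤ 5 := by nlinarith [Real.pi_lt_d2, Real.pi_gt_three]
  nlinarith [mul_le_mul_of_nonneg_right hπ2 n1, mul_le_mul_of_nonneg_right hπ2 n2]

lemma IsLocalMax.second_deriv_nonpos {f f' : ℝ → ℝ} {x₀ f'' : ℝ} (h : IsLocalMax f x₀)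
    (hf : ∀ x, HasDerivAt f (f' x) x) (hf' : HasDerivAt f' f'' x₀) : f'' ≤ 0 := by
  by_contra! hpos
  have hd : deriv f = f' := funext fun x ↦ (hf x).deriv
  have hmin : IsLocalMin f x₀ := isLocalMin_of_deriv_deriv_pos (by rwa [hd, hf'.deriv])
    h.deriv_eq_zero (hf x₀).continuousAt
  have hconst : f =ᶠ[𝓝 x₀] fun _ ↦ f x₀ := by
    filter_upwards [h, hmin] with x h1 h2 using le_antisymm h1 h2
  have : f' =ᶠ[𝓝 x₀] fun _ ↦ 0 := by
    filter_upwards [hconst.eventuallyEq_nhds] with x hx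
    rw [← (hf x).deriv, hx.deriv_eq, deriv_const]
  have := hf'.deriv
  rw [‹f' =ᶠ[𝓝 x₀] _›.deriv_eq, deriv_const] at this
  exact hpos.ne this

lemma fderiv_sq_eq {q : ℂ → ℝ} (hq : ContDiff ℝ 2 q) (z v : ℂ) :
    fderiv ℝ (fun z ↦ q z ^ 2) z v = 2 * (q z * fderiv ℝ q z v) := by
  rw [fderiv_fun_pow 2 ((hq.differentiable (by norm_num)) z)]
  simp [mul_assoc]

lemma fderiv_fderiv_sq_eq {q : ℂ → ℝ} (hq : ContDiff ℝ 2 q) (z v : ℂ) :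
    fderiv ℝ (fderiv ℝ fun z ↦ q z ^ 2) z v v =
      2 * fderiv ℝ q z v ^ 2 + 2 * q z * fderiv ℝ (fderiv ℝ q) z v v := by
  have hd := hq.differentiable (by norm_num)
  have hd' := (hq.fderiv_right (m := 1) (by norm_num)).differentiable (by norm_num)
  have h : fderiv ℝ (fun z ↦ q z ^ 2) = fun z ↦ (2 * q z) • fderiv ℝ q z := by
    ext z v
    simp [fderiv_sq_eq hq, mul_assoc]
  rw [h, fderiv_fun_smul ((hd z).const_mul 2) (hd' z), fderiv_const_mul (hd z)]
  simp
  ring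

lemma norm_sq_mul_laplacian_sq {q : ℂ → ℝ} (hq : ContDiff ℝ 2 q) (z v : ℂ) :
    ‖v‖ ^ 2 * Δ (fun z ↦ q z ^ 2) z = 2 * ‖v‖ ^ 2 * (q z * Δ q z) + 2 * fderiv ℝ q z v ^ 2
      + 2 * fderiv ℝ q z (Complex.I * v) ^ 2 := by
  have h1 := fderiv_fderiv_add_eq_laplacian hq z v
  rw [← fderiv_fderiv_add_eq_laplacian (hq.pow 2) z v, fderiv_fderiv_sq_eq hq,
    fderiv_fderiv_sq_eq hq]
  linear_combination 2 * q z * h1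

/-- Integration over a disc in polar coordinates. -/
lemma setIntegral_ball_eq_polar {q : ℂ → ℝ} (hq : Continuous q) (c : ℂ) {R : ℝ} (hR : 0 ≤ R) :
    ∫ z in Metric.ball c R, q z =
      ∫ r in 0..R, r * ∫ θ in -Real.pi..Real.pi, q (c + r * Complex.exp (θ * Complex.I)) := by
  have h1 : ∫ z in Metric.ball c R, q z
      = ∫ z, (Metric.ball (0 : ℂ) R).indicator (fun z ↦ q (c + z)) z := by
    rw [← integral_indicator Metric.isOpen_ball.measurableSet,
      ← integral_add_left_eq_self _ c]
    congr 1 with z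
    simp [Set.indicator, Metric.mem_ball, dist_eq_norm]
  have hsub : Ioo 0 R ×ˢ Ioo (-Real.pi) Real.pi ⊆ polarCoord.target := by
    rw [polarCoord_target]
    exact prod_mono Ioo_subset_Ioi_self subset_rfl
  have hms : MeasurableSet (Ioo 0 R ×ˢ Ioo (-Real.pi) Real.pi) :=
    measurableSet_Ioo.prod measurableSet_Ioo
  have hcont : Continuous fun x : ℝ × ℝ ↦ x.1 * q (c + x.1 * Complex.exp (x.2 * Complex.I)) := by
    fun_prop
  rw [h1, ← Complex.integral_comp_polarCoord_symm]
  have h2 : EqOn (fun x : ℝ × ℝ ↦ x.1 • (Metric.ball (0 : ℂ) R).indicator (fun z ↦ q (c + z))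
        (Complex.polarCoord.symm x))
      ((Ioo 0 R ×ˢ Ioo (-Real.pi) Real.pi).indicator
        fun x ↦ x.1 * q (c + x.1 * Complex.exp (x.2 * Complex.I))) polarCoord.target := by
    rintro ⟨r, θ⟩ hx
    rw [polarCoord_target] at hx
    have hr : (0 : ℝ) < r := hx.1
    have hθ : θ ∈ Ioo (-Real.pi) Real.pi := hx.2
    by_cases h : r < R
    · simp [Set.indicator, hr, h, hθ.1, hθ.2, abs_of_pos hr, Complex.exp_mul_I]
    · simp [Set.indicator, h, abs_of_pos hr]
  rw [setIntegral_congr_fun polarCoord.open_target.measurableSet h2, setIntegral_indicator hms,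
    inter_eq_right.2 hsub, Measure.volume_eq_prod, setIntegral_prod,
    intervalIntegral.integral_of_le hR, integral_Ioc_eq_integral_Ioo]
  · congr 1 with r
    rw [← intervalIntegral.integral_const_mul,
      intervalIntegral.integral_of_le (by linarith [Real.pi_pos]), integral_Ioc_eq_integral_Ioo]
  · exact (hcont.continuousOn.integrableOn_compact
      ((isCompact_Icc (a := 0) (b := R)).prod (isCompact_Icc (a := -Real.pi) (b := Real.pi)))).mono_set
      (prod_mono Ioo_subset_Icc_self Ioo_subset_Icc_self)

section growth

variable {q : ℂ → ℝ} (hq : ContDiff ℝ 2 q) (c : ℂ)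

include hq

lemma continuous_comp_logPolar (t : ℝ) : Continuous fun θ ↦ q (logPolar c t θ) :=
  hq.continuous.comp ((continuous_logPolar c).comp (Continuous.prodMk_right t))

lemma sq_integral_logPolar_le (t : ℝ) :
    (∫ θ in -Real.pi..Real.pi, q (logPolar c t θ)) ^ 2 ≤
      2 * Real.pi * ∫ θ in -Real.pi..Real.pi, q (logPolar c t θ) ^ 2 := by
  simpa [← two_mul] using sq_intervalIntegral_mul_le (f := fun _ ↦ 1) continuous_const
    (continuous_comp_logPolar hq c t) (a := -Real.pi) (b := Real.pi) (by linarith [Real.pi_pos])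

/-- At a maximum of the weighted circular means of `q ^ 2`, these means are controlled by the lower
bound for the Laplacian of `q`. -/
lemma integral_sq_logPolar_le_of_isLocalMax {S : ℝ} (hS : ∀ z, -S ≤ Δ q z)
    (hq0 : ∀ z, 0 ≤ q z) {t θ₀ : ℝ} (hzero : q (logPolar c t θ₀) = 0)
    (hmax : IsLocalMax (fun s ↦ (∫ θ in -Real.pi..Real.pi, q (logPolar c s θ) ^ 2)
      * Real.exp (-(21 / 25) * s)) t) :
    ∫ θ in -Real.pi..Real.pi, q (logPolar c t θ) ^ 2 ≤ 12000 * S ^ 2 * Real.exp t ^ 4 := by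
  have hπ := Real.pi_pos
  have hπ' : -Real.pi ≤ Real.pi := by linarith
  have hD1 := hq.continuous_fderiv (by norm_num)
  have hL (b : ℂ) : Continuous (logPolar b t) :=
    (continuous_logPolar b).comp (Continuous.prodMk_right t)
  have hLc := hL c
  have hL0 := hL 0
  have hqc := hq.continuous
  have hΔ := continuous_laplacian hq
  have hm := hasDerivAt_integral_logPolar (hq.pow 2) c
  have hm' := hasDerivAt_integral_fderiv_logPolar (hq.pow 2) c t
  set m := fun s ↦ ∫ θ in -Real.pi..Real.pi, q (logPolar c s θ) ^ 2 with hm_def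
  set m' := fun s ↦ ∫ θ in -Real.pi..Real.pi,
    fderiv ℝ (fun z ↦ q z ^ 2) (logPolar c s θ) (logPolar 0 s θ) with hm'_def
  set T := ∫ θ in -Real.pi..Real.pi, fderiv ℝ q (logPolar c t θ) (logPolar 0 t θ) ^ 2 with hT
  set U := ∫ θ in -Real.pi..Real.pi,
    fderiv ℝ q (logPolar c t θ) (Complex.I * logPolar 0 t θ) ^ 2 with hU
  set J := ∫ θ in -Real.pi..Real.pi, q (logPolar c t θ) with hJ
  set m'' := Real.exp t ^ 2 * ∫ θ in -Real.pi..Real.pi, Δ (fun z ↦ q z ^ 2) (logPolar c t θ)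
    with hm''_def
  have hm0 : 0 ≤ m t := intervalIntegral.integral_nonneg hπ' fun θ _ ↦ sq_nonneg _
  have hJ2 : J ^ 2 ≤ 2 * Real.pi * m t := sq_integral_logPolar_le hq c t
  have hJ0 : 0 ≤ J := intervalIntegral.integral_nonneg hπ' fun θ _ ↦ hq0 _
  have hexp (s : ℝ) : HasDerivAt (fun s ↦ Real.exp (-(21 / 25) * s))
      (Real.exp (-(21 / 25) * s) * (-(21 / 25))) s := by
    simpa using ((hasDerivAt_id s).const_mul (-(21 / 25 : ℝ))).exp
  have hG (s : ℝ) := (hm s).mul (hexp s)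
  have hG' := (hm'.mul (hexp t)).add ((hm t).mul ((hexp t).mul_const (-(21 / 25))))
  have h1 := hmax.hasDerivAt_eq_zero (hG t)
  have h2 := hmax.second_deriv_nonpos hG hG'
  have he := Real.exp_pos (-(21 / 25) * t)
  change m' t * _ + m t * _ = 0 at h1
  change m'' * _ + m' t * _ + (m' t * _ + m t * _) ≤ 0 at h2
  have h1' : m' t = 21 / 25 * m t := by
    have : Real.exp (-(21 / 25) * t) * (m' t - 21 / 25 * m t) = 0 := by linarith
    rcases mul_eq_zero.1 this with h | h
    · exact absurd h he.ne'
    · linarith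
  have h2' : m'' ≤ (21 / 25) ^ 2 * m t := by
    rw [h1'] at h2
    have : Real.exp (-(21 / 25) * t) * (m'' - (21 / 25) ^ 2 * m t) ≤ 0 := by linarith
    have := nonpos_of_mul_nonpos_right this he
    linarith
  have hCS : m' t ^ 2 ≤ 4 * (m t * T) := by
    have := sq_intervalIntegral_mul_le (f := fun θ ↦ q (logPolar c t θ))
      (g := fun θ ↦ fderiv ℝ q (logPolar c t θ) (logPolar 0 t θ)) (by fun_prop) (by fun_prop) hπ'
    have e : m' t = 2 * ∫ θ in -Real.pi..Real.pi,
        q (logPolar c t θ) * fderiv ℝ q (logPolar c t θ) (logPolar 0 t θ) := by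
      rw [← intervalIntegral.integral_const_mul]
      simp only [hm'_def, fderiv_sq_eq hq]
    rw [e, mul_pow]
    linarith
  have hW : m t ≤ 5 * U :=
    integral_sq_le_of_periodic_of_eq_zero (hasDerivAt_comp_logPolar_snd hq c t) (by fun_prop)
      (fun θ ↦ by simp only [logPolar_periodic]) (fun θ ↦ by simp only [logPolar_periodic]) hzero
  have hm''_ge : -2 * S * Real.exp t ^ 2 * J + 2 * T + 2 * U ≤ m'' := by
    rw [hJ, hT, hU, hm''_def, ← intervalIntegral.integral_const_mul,
      ← intervalIntegral.integral_const_mul, ← intervalIntegral.integral_const_mul,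
      ← intervalIntegral.integral_const_mul, ← intervalIntegral.integral_add,
      ← intervalIntegral.integral_add]
    · refine intervalIntegral.integral_mono hπ' ?_ ?_ fun θ ↦ ?_
      · apply Continuous.intervalIntegrable; fun_prop
      · have := continuous_laplacian (hq.pow 2)
        apply Continuous.intervalIntegrable; fun_prop
      · have := norm_sq_mul_laplacian_sq hq (logPolar c t θ) (logPolar 0 t θ)
        rw [show ‖logPolar 0 t θ‖ = Real.exp t by simpa using dist_logPolar 0 t θ] at this
        have h3 := mul_le_mul_of_nonneg_left (hS (logPolar c t θ)) (hq0 (logPolar c t θ))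
        have h4 := mul_le_mul_of_nonneg_left h3 (sq_nonneg (Real.exp t))
        beta_reduce
        rw [this]
        linarith
    all_goals apply Continuous.intervalIntegrable; fun_prop
  rcases hm0.eq_or_lt with h0 | h0
  · change m t ≤ _
    rw [← h0]; positivity
  have hT' : (21 / 50) ^ 2 * m t ≤ T := by
    rw [h1'] at hCS
    refine le_of_mul_le_mul_left ?_ h0
    linarith
  have h3 : 59 / 1250 * m t ≤ 2 * S * Real.exp t ^ 2 * J := by linarith
  have h4 : (59 / 1250 * m t) ^ 2 ≤ (2 * S * Real.exp t ^ 2) ^ 2 * (2 * Real.pi * m t) := by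
    calc (59 / 1250 * m t) ^ 2 ≤ (2 * S * Real.exp t ^ 2 * J) ^ 2 := by gcongr
      _ = (2 * S * Real.exp t ^ 2) ^ 2 * J ^ 2 := by ring
      _ ≤ _ := by gcongr
  have h5 : (59 / 1250) ^ 2 * m t ≤ 8 * Real.pi * (S ^ 2 * Real.exp t ^ 4) := by
    refine le_of_mul_le_mul_left ?_ h0
    linarith
  have h6 : 8 * Real.pi * (S ^ 2 * Real.exp t ^ 4) ≤ 8 * 3.15 * (S ^ 2 * Real.exp t ^ 4) := by
    gcongr
    exact Real.pi_lt_d2.le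
  have h7 : 0 ≤ S ^ 2 * Real.exp t ^ 4 := by positivity
  linarith

end growth

section decay

variable {q : ℂ → ℝ} (hq : ContDiff ℝ 2 q) (hqs : HasCompactSupport q) (hq0 : ∀ z, 0 ≤ q z)
  {S : ℝ} (hS0 : 0 ≤ S) (hS : ∀ z, -S ≤ Δ q z) {c : ℂ} (hc : c ∉ tsupport q)
  (hzero : ∀ t, ∃ θ, q (logPolar c t θ) = 0) {B γ : ℝ} (hγ : γ ≤ 2 / 5)
  (hB : ∀ z, q z ≤ B * dist z c ^ γ) {R : ℝ} (hR : 0 < R)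

include hqs hc in
lemma exists_integral_sq_logPolar_eq_zero :
    ∃ t₁ t₂ : ℝ, ∀ t ∉ Icc t₁ t₂, ∫ θ in -Real.pi..Real.pi, q (logPolar c t θ) ^ 2 = 0 := by
  obtain ⟨r₁, hr₁, h₁⟩ := Metric.isOpen_iff.1 (isClosed_tsupport q).isOpen_compl c hc
  obtain ⟨r₂, h₂⟩ := hqs.isCompact.isBounded.subset_closedBall c
  refine ⟨Real.log r₁, Real.log (max r₂ 1), fun t ht ↦ ?_⟩
  have hz (θ : ℝ) : q (logPolar c t θ) = 0 := by
    apply image_eq_zero_of_notMem_tsupport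
    rw [mem_Icc, not_and_or, not_le, not_le] at ht
    rcases ht with ht | ht
    · apply h₁
      rwa [Metric.mem_ball, dist_logPolar, ← Real.lt_log_iff_exp_lt hr₁]
    · intro hmem
      have := h₂ hmem
      rw [Metric.mem_closedBall, dist_logPolar] at this
      rw [Real.log_lt_iff_lt_exp (by positivity)] at ht
      linarith [le_max_left r₂ 1]
  simp [hz]

include hq hqs hq0 hS0 hS hc hzero hγ hB hR

/-- Decay of circular means of a function whose Laplacian is bounded below, around a point such that
every concentric circle meets the zero set of the function. -/
lemma integral_sq_logPolar_le (t : ℝ) :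
    ∫ θ in -Real.pi..Real.pi, q (logPolar c t θ) ^ 2 ≤
      (Real.exp t ^ (21 / 50 : ℝ)
        * (3 * B * R ^ (γ - 21 / 50) + 110 * S * R ^ (2 - 21 / 50 : ℝ))) ^ 2 := by
  have hπ := Real.pi_pos
  have hB0 : 0 ≤ B := by
    have := (hq0 _).trans (hB (c + 1))
    simpa using this
  set m := fun s ↦ ∫ θ in -Real.pi..Real.pi, q (logPolar c s θ) ^ 2 with hm_def
  have hmd := hasDerivAt_integral_logPolar (hq.pow 2) c
  have hmc : Continuous m := continuous_iff_continuousAt.2 fun s ↦ (hmd s).continuousAt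
  set G := fun s ↦ m s * Real.exp (-(21 / 25) * s) with hG
  have hGc : Continuous G := by fun_prop
  have hGs : HasCompactSupport G := by
    obtain ⟨t₁, t₂, h⟩ := exists_integral_sq_logPolar_eq_zero hqs hc
    refine HasCompactSupport.intro (isCompact_Icc (a := t₁) (b := t₂)) fun s hs ↦ ?_
    simp only [hG, hm_def, h s hs, zero_mul]
  obtain ⟨s, hs⟩ := hGc.exists_forall_ge_of_hasCompactSupport hGs
  obtain ⟨θ₀, hθ₀⟩ := hzero s
  have hms : m s ≤ 12000 * S ^ 2 * Real.exp s ^ 4 :=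
    integral_sq_logPolar_le_of_isLocalMax hq c hS hq0 hθ₀ (.of_forall hs)
  have hms' : m s ≤ 2 * Real.pi * (B * Real.exp s ^ γ) ^ 2 := by
    have : m s ≤ ∫ θ in -Real.pi..Real.pi, (B * Real.exp s ^ γ) ^ 2 := by
      refine intervalIntegral.integral_mono (by linarith) ?_ intervalIntegrable_const fun θ ↦ ?_
      · exact ((continuous_comp_logPolar hq c s).pow 2).intervalIntegrable _ _
      · have := hB (logPolar c s θ)
        rw [dist_logPolar] at this
        exact pow_le_pow_left₀ (hq0 _) this 2
    simpa [← two_mul] using this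
  have hX1 : 0 ≤ 3 * B * R ^ (γ - 21 / 50) := by positivity
  have hX2 : 0 ≤ 110 * S * R ^ (2 - 21 / 50 : ℝ) := by positivity
  have hsplit : Real.exp (-(21 / 25) * s) = (Real.exp s ^ (-(21 / 50) : ℝ)) ^ 2 := by
    rw [← Real.exp_mul, ← Real.exp_nat_mul]; congr 1; push_cast; ring
  have hGs : G s ≤ (3 * B * R ^ (γ - 21 / 50) + 110 * S * R ^ (2 - 21 / 50 : ℝ)) ^ 2 := by
    rcases le_total R (Real.exp s) with hRs | hRs
    · calc G s ≤ 2 * Real.pi * (B * Real.exp s ^ γ) ^ 2 * (Real.exp s ^ (-(21 / 50) : ℝ)) ^ 2 := by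
            rw [hG, ← hsplit]; beta_reduce; gcongr
        _ = 2 * Real.pi * (B * Real.exp s ^ (γ - 21 / 50)) ^ 2 := by
            rw [sub_eq_add_neg, Real.rpow_add (Real.exp_pos s)]; ring
        _ ≤ 9 * (B * R ^ (γ - 21 / 50)) ^ 2 := by
            have h1 : Real.exp s ^ (γ - 21 / 50) ≤ R ^ (γ - 21 / 50) :=
              Real.rpow_le_rpow_of_nonpos hR hRs (by linarith)
            have h2 := Real.pi_lt_d2
            gcongr
            linarith
        _ = (3 * B * R ^ (γ - 21 / 50)) ^ 2 := by ring
        _ ≤ _ := by gcongr; linarith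
    · calc G s ≤ 12000 * S ^ 2 * Real.exp s ^ 4 * (Real.exp s ^ (-(21 / 50) : ℝ)) ^ 2 := by
            rw [hG, ← hsplit]; beta_reduce; gcongr
        _ = 12000 * S ^ 2 * (Real.exp s ^ (2 - 21 / 50 : ℝ)) ^ 2 := by
            rw [sub_eq_add_neg, Real.rpow_add (Real.exp_pos s), Real.rpow_two]; ring
        _ ≤ 12100 * S ^ 2 * (R ^ (2 - 21 / 50 : ℝ)) ^ 2 := by
            gcongr; norm_num
        _ = (110 * S * R ^ (2 - 21 / 50 : ℝ)) ^ 2 := by ring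
        _ ≤ _ := by gcongr; linarith
  have hsplit' : m t = G t * (Real.exp t ^ (21 / 50 : ℝ)) ^ 2 := by
    rw [hG, mul_assoc, ← Real.exp_mul, ← Real.exp_nat_mul, ← Real.exp_add]
    ring_nf
    simp
  calc m t = G t * (Real.exp t ^ (21 / 50 : ℝ)) ^ 2 := hsplit'
    _ ≤ _ := by
      rw [mul_pow, mul_comm]
      exact mul_le_mul_of_nonneg_left ((hs t).trans hGs) (sq_nonneg _)

/-- Pointwise decay of a function whose Laplacian is bounded below, around a point such that every
concentric circle meets the zero set of the function. -/
lemma le_of_forall_circle_zero {w : ℂ} (hwc : w ≠ c) :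
    q w ≤ 4 * dist w c ^ (21 / 50 : ℝ)
      * (3 * B * R ^ (γ - 21 / 50) + 110 * S * R ^ (2 - 21 / 50 : ℝ)) + S * dist w c ^ 2 := by
  have hπ := Real.pi_pos
  set ρ := dist w c with hρ
  have hρ0 : 0 < ρ := dist_pos.2 hwc
  have hB0 : 0 ≤ B := by
    have := (hq0 _).trans (hB (c + 1))
    simpa using this
  set X := 3 * B * R ^ (γ - 21 / 50) + 110 * S * R ^ (2 - 21 / 50 : ℝ) with hX
  have hX0 : 0 ≤ X := by positivity
  have hqc := hq.continuous
  have hcontJ (b : ℂ) : Continuous fun r : ℝ ↦ r * ∫ θ in -Real.pi..Real.pi,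
      q (b + r * Complex.exp (θ * Complex.I)) := by
    refine continuous_id.mul ?_
    apply intervalIntegral.continuous_parametric_intervalIntegral_of_continuous'
    fun_prop
  have hupper : ∫ z in Metric.ball c (2 * ρ), q z ≤ 12 * ρ ^ 2 * (ρ ^ (21 / 50 : ℝ) * X) := by
    rw [setIntegral_ball_eq_polar hqc c (by linarith)]
    have : ∫ r in 0..2 * ρ, r * ∫ θ in -Real.pi..Real.pi, q (c + r * Complex.exp (θ * Complex.I))
        ≤ ∫ r in 0..2 * ρ, r * (6 * (ρ ^ (21 / 50 : ℝ) * X)) := by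
      refine intervalIntegral.integral_mono_on (by linarith) ((hcontJ c).intervalIntegrable _ _)
        (by apply Continuous.intervalIntegrable; fun_prop) fun r hr ↦ ?_
      rcases hr.1.eq_or_lt with h0 | h0
      · simp [← h0]
      have h1 := sq_integral_logPolar_le hq c (Real.log r)
      have h2 := integral_sq_logPolar_le hq hqs hq0 hS0 hS hc hzero hγ hB hR (Real.log r)
      simp only [logPolar_eq, Real.exp_log h0] at h1 h2
      have h3 : r ^ (21 / 50 : ℝ) ≤ 2 * ρ ^ (21 / 50 : ℝ) := by
        calc r ^ (21 / 50 : ℝ) ≤ (2 * ρ) ^ (21 / 50 : ℝ) :=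
              Real.rpow_le_rpow h0.le hr.2 (by norm_num)
          _ = 2 ^ (21 / 50 : ℝ) * ρ ^ (21 / 50 : ℝ) := Real.mul_rpow (by norm_num) hρ0.le
          _ ≤ 2 * ρ ^ (21 / 50 : ℝ) := by
              gcongr
              exact Real.rpow_le_self_of_one_le (by norm_num) (by norm_num)
      refine mul_le_mul_of_nonneg_left ?_ h0.le
      refine abs_le_of_sq_le_sq' ?_ (by positivity) |>.2
      refine (h1.trans (mul_le_mul_of_nonneg_left h2 (by positivity))).trans ?_
      calc 2 * Real.pi * (r ^ (21 / 50 : ℝ) * X) ^ 2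
          ≤ 9 * (2 * ρ ^ (21 / 50 : ℝ) * X) ^ 2 := by
            have := Real.pi_lt_d2
            gcongr
            linarith
        _ = (6 * (ρ ^ (21 / 50 : ℝ) * X)) ^ 2 := by ring
    refine this.trans_eq ?_
    rw [intervalIntegral.integral_mul_const, integral_id]
    ring
  have hlower : Real.pi * ρ ^ 2 * q w - Real.pi / 8 * S * ρ ^ 4 ≤ ∫ z in Metric.ball w ρ, q z := by
    rw [setIntegral_ball_eq_polar hqc w hρ0.le]
    have : ∫ r in 0..ρ, (2 * Real.pi * q w * r ^ 1 - Real.pi / 2 * S * r ^ 3)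
        ≤ ∫ r in 0..ρ, r * ∫ θ in -Real.pi..Real.pi, q (w + r * Complex.exp (θ * Complex.I)) := by
      refine intervalIntegral.integral_mono_on hρ0.le
        (by apply Continuous.intervalIntegrable; fun_prop)
        ((hcontJ w).intervalIntegrable _ _) fun r hr ↦ ?_
      rcases hr.1.eq_or_lt with h0 | h0
      · simp [← h0]
      have h1 := two_pi_mul_le_integral_logPolar hq hS w (Real.log r)
      simp only [logPolar_eq, Real.exp_log h0] at h1
      have := mul_le_mul_of_nonneg_left h1 h0.le
      linarith
    refine le_trans (le_of_eq ?_) this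
    rw [intervalIntegral.integral_sub, intervalIntegral.integral_const_mul,
      intervalIntegral.integral_const_mul, integral_pow, integral_pow]
    · norm_num
      ring
    all_goals apply Continuous.intervalIntegrable; fun_prop
  have hmono : ∫ z in Metric.ball w ρ, q z ≤ ∫ z in Metric.ball c (2 * ρ), q z := by
    refine setIntegral_mono_set (hqc.integrable_of_hasCompactSupport hqs).integrableOn
      (.of_forall hq0) (Metric.ball_subset_ball' (by linarith)).eventuallyLE
  have hfin : ρ ^ 2 * (Real.pi * q w) ≤
      ρ ^ 2 * (12 * (ρ ^ (21 / 50 : ℝ) * X) + Real.pi * (S * ρ ^ 2)) := by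
    have : 0 ≤ Real.pi * S * ρ ^ 4 := by positivity
    linarith
  have hfin' := le_of_mul_le_mul_left hfin (by positivity)
  have h12 : 12 * (ρ ^ (21 / 50 : ℝ) * X) ≤ Real.pi * (4 * (ρ ^ (21 / 50 : ℝ) * X)) := by
    have : 0 ≤ ρ ^ (21 / 50 : ℝ) * X := by positivity
    nlinarith [Real.pi_gt_three]
  refine le_of_mul_le_mul_left (hfin'.trans ?_) hπ
  linarith

end decay

/-- A circle around a point outside a simply connected plane domain is not contained in it. -/
lemma exists_logPolar_notMem {Ω : Set ℂ} (hΩ : IsOpen Ω) (hsc : SimplyConnectedSpace Ω) {c : ℂ}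
    (hc : c ∉ Ω) (t : ℝ) : ∃ θ, logPolar c t θ ∉ Ω := by
  by_contra! hmem
  obtain ⟨L, hLc, hL⟩ := Complex.exists_continuousOn_eqOn_exp_comp (U := Ω) hsc hΩ
    (g := fun z ↦ z - c) (by fun_prop) (by
      rintro ⟨z, hz, hzc⟩
      exact hc (sub_eq_zero.1 hzc ▸ hz))
  have hcirc : Continuous (logPolar c t) := (continuous_logPolar c).comp (Continuous.prodMk_right t)
  have hf : Continuous fun θ : ℝ ↦ L (logPolar c t θ) - (t + θ * Complex.I) :=
    (hLc.comp_continuous hcirc hmem).sub (by fun_prop)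
  have hone (θ : ℝ) : ∃ n : ℤ,
      L (logPolar c t θ) - (t + θ * Complex.I) = n * (2 * Real.pi * Complex.I) := by
    rw [← Complex.exp_eq_one_iff, Complex.exp_sub, div_eq_one_iff_eq (Complex.exp_ne_zero _)]
    simpa [logPolar] using hL (hmem θ)
  choose n hn using hone
  have hncont : Continuous n := by
    rw [Int.isClosedEmbedding_coe_real.isInducing.continuous_iff]
    have : ((↑) : ℤ → ℝ) ∘ n =
        fun θ : ℝ ↦ (L (logPolar c t θ) - (t + θ * Complex.I)).im / (2 * Real.pi) := by
      ext θ
      rw [hn]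
      simp
    rw [this]
    exact (Complex.continuous_im.comp hf).div_const _
  have hnpi : n Real.pi = n (-Real.pi) := PreconnectedSpace.constant inferInstance hncont
  have hpi : logPolar c t Real.pi = logPolar c t (-Real.pi) := by
    rw [← logPolar_periodic c t (-Real.pi)]; congr 1; ring
  have h1 := hn Real.pi
  have h2 := hn (-Real.pi)
  rw [hnpi, hpi, ← h2] at h1
  have := congrArg Complex.im h1
  simp at this
  linarith [Real.pi_pos]

/-- A `C²` convex truncation of the positive part. -/
lemma exists_contDiff_truncation {σ : ℝ} (hσ : 0 < σ) : ∃ φ : ℝ → ℝ, ContDiff ℝ 2 φ ∧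
    (∀ x ≤ 0, φ x = 0) ∧ (∀ x, 0 ≤ φ x) ∧ (∀ x, x - σ ≤ φ x) ∧ (∀ x, φ x ≤ max x 0) ∧
    (∀ x, 0 ≤ deriv φ x) ∧ (∀ x, deriv φ x ≤ 1) ∧ ∀ x, 0 ≤ deriv (deriv φ) x := by
  set f : ℝ → ℝ := fun x ↦ Real.smoothTransition (x / σ) with hf
  have hfs : ContDiff ℝ 1 f := (Real.smoothTransition.contDiff (n := 1)).comp (contDiff_id.div_const σ)
  have hfc : Continuous f := hfs.continuous
  have hfm : Monotone f := fun x y hxy ↦ Real.smoothTransition.monotone (by gcongr)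
  have hf0 (x : ℝ) : 0 ≤ f x := Real.smoothTransition.nonneg _
  have hf1 (x : ℝ) : f x ≤ 1 := Real.smoothTransition.le_one _
  have hfn (x : ℝ) (hx : x ≤ 0) : f x = 0 :=
    Real.smoothTransition.zero_of_nonpos (div_nonpos_of_nonpos_of_nonneg hx hσ.le)
  have hfp (x : ℝ) (hx : σ ≤ x) : f x = 1 :=
    Real.smoothTransition.one_of_one_le ((one_le_div hσ).2 hx)
  set φ : ℝ → ℝ := fun x ↦ ∫ s in 0..x, f s with hφ
  have hd (x : ℝ) : HasDerivAt φ (f x) x := intervalIntegral.integral_hasDerivAt_right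
    (hfc.intervalIntegrable _ _) (hfc.stronglyMeasurableAtFilter _ _) hfc.continuousAt
  have hdφ : deriv φ = f := funext fun x ↦ (hd x).deriv
  have hφd : Differentiable ℝ φ := fun x ↦ (hd x).differentiableAt
  have hφm : Monotone φ := monotone_of_deriv_nonneg hφd fun x ↦ by rw [hdφ]; exact hf0 x
  have hφn (x : ℝ) (hx : x ≤ 0) : φ x = 0 := by
    have : ∫ s in 0..x, f s = ∫ s in 0..x, (0 : ℝ) := by
      refine intervalIntegral.integral_congr fun s hs ↦ hfn s ?_
      rw [uIcc_of_ge hx] at hs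
      exact hs.2
    simpa [hφ] using this
  have hφ0 (x : ℝ) : 0 ≤ φ x := by
    rcases le_total x 0 with h | h
    · exact (hφn x h).ge
    · exact (hφn 0 le_rfl).symm.le.trans (hφm h)
  have hanti : Antitone fun x ↦ φ x - x := by
    refine antitone_of_deriv_nonpos (hφd.sub differentiable_id) fun x ↦ ?_
    rw [((hd x).fun_sub (hasDerivAt_id' x)).deriv]
    linarith [hf1 x]
  refine ⟨φ, ?_, hφn, hφ0, fun x ↦ ?_, fun x ↦ ?_, fun x ↦ ?_, fun x ↦ ?_, fun x ↦ ?_⟩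
  · rw [show (2 : WithTop ℕ∞) = 1 + 1 by norm_num, contDiff_succ_iff_deriv]
    exact ⟨hφd, by simp, by rwa [hdφ]⟩
  · rcases le_total x σ with h | h
    · linarith [hφ0 x]
    · have h1 : ∫ s in σ..x, f s = ∫ s in σ..x, (1 : ℝ) := by
        refine intervalIntegral.integral_congr fun s hs ↦ hfp s ?_
        rw [uIcc_of_le h] at hs
        exact hs.1
      have h2 : φ σ + ∫ s in σ..x, f s = φ x := intervalIntegral.integral_add_adjacent_intervals
        (hfc.intervalIntegrable _ _) (hfc.intervalIntegrable _ _)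
      rw [h1, intervalIntegral.integral_const, smul_eq_mul, mul_one] at h2
      linarith [hφ0 σ]
  · rcases le_total x 0 with h | h
    · rw [hφn x h]; exact le_max_right _ _
    · have := hanti h
      simp only [hφn 0 le_rfl] at this
      linarith [le_max_left x 0]
  · rw [hdφ]; exact hf0 x
  · rw [hdφ]; exact hf1 x
  · rw [hdφ]; exact hfm.deriv_nonneg

lemma fderiv_fderiv_comp_real_eq {φ : ℝ → ℝ} {h : ℂ → ℝ} (hφ : ContDiff ℝ 2 φ) {z : ℂ}
    (hh : ContDiffAt ℝ 2 h z) (v : ℂ) :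
    fderiv ℝ (fderiv ℝ fun z ↦ φ (h z)) z v v =
      deriv (deriv φ) (h z) * fderiv ℝ h z v ^ 2
        + deriv φ (h z) * fderiv ℝ (fderiv ℝ h) z v v := by
  have hφ' : ContDiff ℝ 1 (deriv φ) := by
    rw [show (2 : WithTop ℕ∞) = 1 + 1 by norm_num, contDiff_succ_iff_deriv] at hφ
    exact hφ.2.2
  have hev : fderiv ℝ (fun z ↦ φ (h z)) =ᶠ[𝓝 z] fun y ↦ deriv φ (h y) • fderiv ℝ h y := by
    filter_upwards [hh.eventually (by simp)] with y hy
    exact (((hφ.differentiable (by norm_num)) (h y)).hasDerivAt.comp_hasFDerivAt y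
      (hy.differentiableAt (by norm_num)).hasFDerivAt).fderiv
  have hd : HasFDerivAt h (fderiv ℝ h z) z := (hh.differentiableAt (by norm_num)).hasFDerivAt
  have hd' : DifferentiableAt ℝ (fderiv ℝ h) z :=
    (hh.fderiv_right (m := 1) (by norm_num)).differentiableAt (by norm_num)
  have hdφ' := ((hφ'.differentiable (by norm_num)) (h z)).hasDerivAt.comp_hasFDerivAt z hd
  rw [hev.fderiv_eq, show fderiv ℝ (fun y ↦ deriv φ (h y) • fderiv ℝ h y) z = _ from
    (hdφ'.smul hd'.hasFDerivAt).fderiv]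
  simp
  ring

lemma deriv_mul_laplacian_le_laplacian_comp {φ : ℝ → ℝ} {h : ℂ → ℝ} (hφ : ContDiff ℝ 2 φ)
    (hconv : ∀ x, 0 ≤ deriv (deriv φ) x) {z : ℂ} (hh : ContDiffAt ℝ 2 h z) :
    deriv φ (h z) * Δ h z ≤ Δ (fun z ↦ φ (h z)) z := by
  rw [laplacian_eq_fderiv, laplacian_eq_fderiv, fderiv_fderiv_comp_real_eq hφ hh,
    fderiv_fderiv_comp_real_eq hφ hh]
  have h1 := mul_nonneg (hconv (h z)) (sq_nonneg (fderiv ℝ h z 1))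
  have h2 := mul_nonneg (hconv (h z)) (sq_nonneg (fderiv ℝ h z Complex.I))
  linarith

section domain

variable {Ω : Set ℂ} (hΩ : IsOpen Ω) (hb : Bornology.IsBounded Ω) {h : ℂ → ℝ}
  (hcont : ContinuousOn h (closure Ω)) (hbd : ∀ x ∈ frontier Ω, h x = 0)

include hΩ hbd in
lemma superlevel_subset {l : ℝ} (hl : 0 < l) : {z ∈ closure Ω | l ≤ h z} ⊆ Ω := by
  rintro z ⟨hz, hlz⟩
  by_contra hzΩ
  have : h z = 0 := hbd z ⟨hz, by rwa [hΩ.interior_eq]⟩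
  linarith

include hb hcont in
lemma isCompact_superlevel (l : ℝ) : IsCompact {z ∈ closure Ω | l ≤ h z} :=
  hb.isCompact_closure.of_isClosed_subset
    (hcont.preimage_isClosed_of_isClosed isClosed_closure isClosed_Ici) fun _ hz ↦ hz.1

include hΩ hb hcont hbd in
/-- A smooth compactly supported truncation of `h` above the level `l`, inheriting a lower bound for
the Laplacian of `h` on the superlevel set. -/
lemma exists_truncation (hsm : ContDiffOn ℝ 2 h Ω) {l σ S : ℝ} (hl : 0 < l) (hσ : 0 < σ)
    (hS0 : 0 ≤ S) (hS : ∀ z ∈ Ω, l ≤ h z → -S ≤ Δ h z) :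
    ∃ q : ℂ → ℝ, ContDiff ℝ 2 q ∧ HasCompactSupport q ∧ tsupport q ⊆ Ω ∧ (∀ z, 0 ≤ q z) ∧
      (∀ z, -S ≤ Δ q z) ∧ (∀ z ∈ Ω, h z - l - σ ≤ q z) ∧ ∀ z ∈ Ω, q z ≤ max (h z - l) 0 := by
  classical
  obtain ⟨φ, hφ, hφn, hφ0, hφl, hφu, hφ'0, hφ'1, hφ''⟩ := exists_contDiff_truncation hσ
  set K := {z ∈ closure Ω | l ≤ h z} with hK
  have hKc : IsCompact K := isCompact_superlevel hb hcont l
  have hKΩ : K ⊆ Ω := superlevel_subset hΩ hbd hl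
  set q : ℂ → ℝ := Ω.indicator fun z ↦ φ (h z - l) with hq
  have hqK (z : ℂ) (hz : z ∉ K) : q z = 0 := by
    by_cases hzΩ : z ∈ Ω
    · rw [hq, indicator_of_mem hzΩ]
      refine hφn _ ?_
      by_contra! hlt
      exact hz ⟨subset_closure hzΩ, by linarith⟩
    · rw [hq, indicator_of_notMem hzΩ]
  have hevK (z : ℂ) (hz : z ∉ K) : q =ᶠ[𝓝 z] fun _ ↦ 0 := by
    filter_upwards [hKc.isClosed.isOpen_compl.mem_nhds hz] with y hy using hqK y hy
  have hevΩ (z : ℂ) (hz : z ∈ Ω) : q =ᶠ[𝓝 z] fun y ↦ φ (h y - l) := by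
    filter_upwards [hΩ.mem_nhds hz] with y hy
    rw [hq, indicator_of_mem hy]
  have hts : tsupport q ⊆ K := closure_minimal
    (fun z hz ↦ by_contra fun hzK ↦ hz (hqK z hzK)) hKc.isClosed
  refine ⟨q, ?_, hKc.of_isClosed_subset (isClosed_tsupport q) hts, hts.trans hKΩ, fun z ↦ ?_,
    fun z ↦ ?_, fun z hz ↦ ?_, fun z hz ↦ ?_⟩
  · rw [contDiff_iff_contDiffAt]
    intro z
    by_cases hz : z ∈ K
    · refine ContDiffAt.congr_of_eventuallyEq ?_ (hevΩ z (hKΩ hz))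
      exact hφ.contDiffAt.comp z
        ((hsm.contDiffAt (hΩ.mem_nhds (hKΩ hz))).sub contDiffAt_const)
    · exact contDiffAt_const.congr_of_eventuallyEq (hevK z hz)
  · exact indicator_nonneg (fun y _ ↦ hφ0 _) z
  · by_cases hz : z ∈ K
    · have hd : deriv (fun x ↦ φ (x - l)) = fun x ↦ deriv φ (x - l) :=
        funext fun x ↦ deriv_comp_sub_const ..
      have hd2 (x : ℝ) : 0 ≤ deriv (deriv fun x ↦ φ (x - l)) x := by
        rw [hd, deriv_comp_sub_const]
        exact hφ'' _
      have hlap := deriv_mul_laplacian_le_laplacian_comp (φ := fun x ↦ φ (x - l))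
        (hφ.comp (contDiff_id.sub contDiff_const)) hd2 (hsm.contDiffAt (hΩ.mem_nhds (hKΩ hz)))
      rw [(InnerProductSpace.laplacian_congr_nhds (hevΩ z (hKΩ hz))).self_of_nhds]
      refine le_trans ?_ hlap
      rw [hd]
      have h1 := hS z (hKΩ hz) hz.2
      nlinarith [hφ'0 (h z - l), hφ'1 (h z - l)]
    · rw [(InnerProductSpace.laplacian_congr_nhds (hevK z hz)).self_of_nhds]
      simpa [laplacian_eq_fderiv] using hS0
  · rw [hq, indicator_of_mem hz]
    exact hφl _
  · rw [hq, indicator_of_mem hz]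
    exact hφu _

end domain

lemma infDist_compl_le_one {Ω : Set ℂ} (hb : Bornology.IsBounded Ω) (hdiam : Metric.diam Ω ≤ 1)
    {w : ℂ} (hw : w ∈ Ω) : Metric.infDist w Ωᶜ ≤ 1 := by
  by_contra! hlt
  obtain ⟨s, hs1, hs⟩ := exists_between hlt
  have hmem : w + s ∈ Ω := by
    by_contra hn
    have := Metric.infDist_le_dist_of_mem (x := w) (show w + (s : ℂ) ∈ Ωᶜ from hn)
    rw [dist_self_add_right, Complex.norm_real, Real.norm_of_nonneg (by linarith)] at this
    linarith
  have := Metric.dist_le_diam_of_mem hb hw hmem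
  rw [dist_self_add_right, Complex.norm_real, Real.norm_of_nonneg (by linarith)] at this
  linarith

/-- The estimate from above, for functions whose Laplacian is bounded below near the boundary. -/
lemma exists_le_mul_infDist_rpow {α : ℝ} (hα : α ∈ Ioc (0 : ℝ) 2) :
    ∃ C > (0 : ℝ), ∀ Ω : Set ℂ, IsOpen Ω → SimplyConnectedSpace Ω → Bornology.IsBounded Ω →
      Metric.diam Ω ≤ 1 → ∀ h : ℂ → ℝ, ContDiffOn ℝ 2 h Ω → ContinuousOn h (closure Ω) →
      (∀ x ∈ frontier Ω, h x = 0) →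
      (∀ u ∈ Ω, -(Metric.infDist u Ωᶜ ^ (-2 + α)) ≤ Δ h u) →
      ∀ w ∈ Ω, h w ≤ C * Metric.infDist w Ωᶜ ^ (α / 5) := by
  obtain ⟨hα0, hα2⟩ := hα
  set γ := α / 5 with hγ
  have hγ0 : 0 < γ := by positivity
  set D : ℝ := ((1 / 4 : ℝ) ^ (1 / γ)) ^ (-2 + α) with hD
  have hD0 : 0 < D := by positivity
  set K : ℝ := 48 ^ (50 : ℝ) with hK
  have hK1 : 1 ≤ K := Real.one_le_rpow (by norm_num) (by norm_num)
  have hK0 : 0 < K := by positivity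
  have hKγ : K ^ (γ - 21 / 50) ≤ 1 / 48 := by
    calc K ^ (γ - 21 / 50) ≤ K ^ (-1 / 50 : ℝ) :=
          Real.rpow_le_rpow_of_exponent_le hK1 (by rw [hγ]; linarith)
      _ = 1 / 48 := by
          rw [hK, ← Real.rpow_mul (by norm_num)]
          norm_num
  refine ⟨4 * D * (440 * K ^ (2 - 21 / 50 : ℝ) + 1), by positivity, ?_⟩
  set C := 4 * D * (440 * K ^ (2 - 21 / 50 : ℝ) + 1) with hC
  have hC0 : 0 < C := by positivity
  intro Ω hΩ hsc hb hdiam h hsm hcont hbd hlap w hw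
  refine le_of_forall_pos_le_add fun ε hε ↦ ?_
  set d : ℂ → ℝ := fun z ↦ Metric.infDist z Ωᶜ with hd
  have hne : (Ωᶜ).Nonempty := by
    rw [nonempty_compl]
    rintro rfl
    exact NormedSpace.unbounded_univ ℝ ℂ hb
  have hd0 (z : ℂ) (hz : z ∈ Ω) : 0 < d z :=
    (hΩ.isClosed_compl.notMem_iff_infDist_pos hne).1 fun h ↦ h hz
  set E := {z ∈ closure Ω | ε ≤ h z} with hE
  have hEΩ : E ⊆ Ω := superlevel_subset hΩ hbd hε
  by_cases hwE : w ∈ E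
  swap
  · have : h w < ε := by
      by_contra! hle
      exact hwE ⟨subset_closure hw, hle⟩
    have : 0 ≤ C * d w ^ γ := by have := hd0 w hw; positivity
    linarith
  obtain ⟨v, hvE, hvmax⟩ := (isCompact_superlevel hb hcont ε).exists_isMaxOn ⟨w, hwE⟩
    (f := fun z ↦ (h z - ε) / d z ^ γ) (by
      refine ((hcont.mono fun z hz ↦ hz.1).sub continuousOn_const).div
        ((Metric.continuous_infDist_pt _).continuousOn.rpow_const fun z _ ↦ .inr hγ0.le)
        fun z hz ↦ ?_
      have := hd0 z (hEΩ hz)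
      positivity)
  have hv := hEΩ hvE
  set A := (h v - ε) / d v ^ γ with hA
  have hA0 : 0 ≤ A := div_nonneg (by linarith [hvE.2]) (by have := hd0 v hv; positivity)
  have hle (z : ℂ) (hz : z ∈ Ω) : h z - ε ≤ A * d z ^ γ := by
    have hdz := Real.rpow_pos_of_pos (hd0 z hz) γ
    by_cases hzE : z ∈ E
    · exact (div_le_iff₀ hdz).1 (hvmax hzE)
    · have : h z < ε := by
        by_contra! hle
        exact hzE ⟨subset_closure hz, hle⟩
      have : 0 ≤ A * d z ^ γ := by positivity
      linarith
  suffices hAC : A ≤ C by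
    have h1 := hle w hw
    have h2 := mul_le_mul_of_nonneg_right hAC (Real.rpow_nonneg (hd0 w hw).le γ)
    linarith
  rcases hA0.eq_or_lt with h0 | hApos
  · rw [← h0]; exact hC0.le
  set ρ := d v with hρ
  have hρ0 : 0 < ρ := hd0 v hv
  have hρ1 : ρ ≤ 1 := infDist_compl_le_one hb hdiam hv
  have hρp (x : ℝ) : 0 < ρ ^ x := Real.rpow_pos_of_pos hρ0 x
  have hAρ : A * ρ ^ γ = h v - ε := div_mul_cancel₀ _ (hρp γ).ne'
  set a := A * ρ ^ γ with ha
  have ha0 : 0 < a := mul_pos hApos (hρp γ)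
  set S := D * ρ ^ (-2 + α) with hS
  have hS0 : 0 ≤ S := (mul_pos hD0 (hρp _)).le
  have hlapS : ∀ z ∈ Ω, ε + a / 4 ≤ h z → -S ≤ Δ h z := by
    intro z hz hlz
    have h1 : 1 / 4 * ρ ^ γ ≤ d z ^ γ := by
      refine le_of_mul_le_mul_left ?_ hApos
      have := hle z hz
      linarith
    have h2 : (1 / 4 : ℝ) ^ (1 / γ) * ρ ≤ d z := by
      rw [← Real.rpow_le_rpow_iff (by positivity) (hd0 z hz).le hγ0,
        Real.mul_rpow (by positivity) hρ0.le, ← Real.rpow_mul (by norm_num),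
        one_div_mul_cancel hγ0.ne', Real.rpow_one]
      exact h1
    have h3 : d z ^ (-2 + α) ≤ S := by
      rw [hS, hD, ← Real.mul_rpow (by positivity) hρ0.le]
      exact Real.rpow_le_rpow_of_nonpos (by positivity) h2 (by linarith)
    have := hlap z hz
    linarith
  obtain ⟨q, hq, hqs, hqΩ, hq0, hqS, hql, hqu⟩ := exists_truncation hΩ hb hcont hbd hsm
    (l := ε + a / 4) (σ := a / 4) (by linarith) (by linarith) hS0 hlapS
  obtain ⟨c, hcΩ, hc⟩ := hΩ.isClosed_compl.exists_infDist_eq_dist hne v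
  have hqout (z : ℂ) (hz : z ∉ Ω) : q z = 0 :=
    image_eq_zero_of_notMem_tsupport fun h ↦ hz (hqΩ h)
  have hqB (z : ℂ) : q z ≤ A * dist z c ^ γ := by
    have h0 : 0 ≤ A * dist z c ^ γ := by positivity
    by_cases hz : z ∈ Ω
    · refine (hqu z hz).trans (max_le ?_ h0)
      have h1 : A * d z ^ γ ≤ A * dist z c ^ γ := by
        have := hd0 z hz
        gcongr
        exact Metric.infDist_le_dist_of_mem hcΩ
      linarith [hle z hz]
    · rwa [hqout z hz]
  have hvc : v ≠ c := fun e ↦ hcΩ (e ▸ hv)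
  have key := le_of_forall_circle_zero hq hqs hq0 hS0 hqS (c := c) (fun h ↦ hcΩ (hqΩ h))
    (fun t ↦ (exists_logPolar_notMem hΩ hsc hcΩ t).imp fun θ hθ ↦ hqout _ hθ)
    (γ := γ) (by rw [hγ]; linarith) hqB (R := K * ρ) (by positivity) hvc
  rw [← hc] at key
  change q v ≤ 4 * ρ ^ (21 / 50 : ℝ) * _ + S * ρ ^ 2 at key
  rw [Real.mul_rpow hK0.le hρ0.le, Real.mul_rpow hK0.le hρ0.le] at key
  have e1 : ρ ^ (21 / 50 : ℝ) * ρ ^ (γ - 21 / 50) = ρ ^ γ := by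
    rw [← Real.rpow_add hρ0]; congr 1; ring
  have e2 : ρ ^ (21 / 50 : ℝ) * ρ ^ (2 - 21 / 50 : ℝ) = ρ ^ 2 := by
    rw [← Real.rpow_add hρ0, ← Real.rpow_two]; congr 1; norm_num
  have e3 : S * ρ ^ 2 = D * ρ ^ α := by
    rw [hS, mul_assoc, ← Real.rpow_two, ← Real.rpow_add hρ0]; congr 2; ring
  have e4 : ρ ^ α ≤ ρ ^ γ :=
    Real.rpow_le_rpow_of_exponent_ge hρ0 hρ1 (by rw [hγ]; linarith)
  have key2 : q v ≤ 12 * A * K ^ (γ - 21 / 50) * ρ ^ γ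
      + (440 * K ^ (2 - 21 / 50 : ℝ) + 1) * (D * ρ ^ α) := by
    refine key.trans_eq ?_
    rw [← e3, ← e1]
    linear_combination 440 * S * K ^ (2 - 21 / 50 : ℝ) * e2
  have h1 : 12 * A * K ^ (γ - 21 / 50) * ρ ^ γ ≤ 12 * A * (1 / 48) * ρ ^ γ := by
    gcongr
  have h2 : (440 * K ^ (2 - 21 / 50 : ℝ) + 1) * (D * ρ ^ α)
      ≤ (440 * K ^ (2 - 21 / 50 : ℝ) + 1) * (D * ρ ^ γ) := by
    gcongr
  have h3 := hql v hv
  have h4 : A * ρ ^ γ ≤ C * ρ ^ γ := by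
    rw [hC]
    linarith
  exact le_of_mul_le_mul_right h4 (hρp γ)

/-- Lemma A.2: quantitative boundary estimate for the Poisson equation with a
source blowing up like `d_u^{−2+α}` near the boundary; one may take the
exponent `β(α) = α/5`. -/
theorem poisson_boundary_estimate
    (α : ℝ) (hα : α ∈ Set.Ioc (0 : ℝ) 2) :
    ∃ C > (0 : ℝ), ∀ Ω : Set ℂ, IsOpen Ω → IsConnected Ω →
      SimplyConnectedSpace ↥Ω → Bornology.IsBounded Ω → Metric.diam Ω ≤ 1 →
      ∀ h : ℂ → ℝ, ContDiffOn ℝ 2 h Ω → ContinuousOn h (closure Ω) →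
      (∀ x ∈ frontier Ω, h x = 0) →
      (∀ u ∈ Ω,
        |iteratedFDeriv ℝ 2 h u ![1, 1]
            + iteratedFDeriv ℝ 2 h u ![Complex.I, Complex.I]|
          ≤ Metric.infDist u Ωᶜ ^ (-2 + α)) →
      ∀ w ∈ Ω, |h w| ≤ C * Metric.infDist w Ωᶜ ^ (α / 5) := by
  obtain ⟨C, hC, hmain⟩ := exists_le_mul_infDist_rpow hα
  refine ⟨C, hC, fun Ω hΩ _ hsc hb hdiam h hsm hcont hbd hlap w hw ↦ ?_⟩
  have hlap' (u : ℂ) (hu : u ∈ Ω) : |Δ h u| ≤ Metric.infDist u Ωᶜ ^ (-2 + α) := by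
    simpa only [InnerProductSpace.laplacian_eq_iteratedFDeriv_complexPlane] using hlap u hu
  rw [abs_le']
  constructor
  · exact hmain Ω hΩ hsc hb hdiam h hsm hcont hbd (fun u hu ↦ (abs_le.1 (hlap' u hu)).1) w hw
  · refine hmain Ω hΩ hsc hb hdiam (-h) hsm.neg hcont.neg (fun x hx ↦ by simp [hbd x hx])
      (fun u hu ↦ ?_) w hw
    rw [InnerProductSpace.laplacian_neg, Pi.neg_apply]
    exact neg_le_neg (abs_le.1 (hlap' u hu)).2
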